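/- arXiv:math-ph/9903032 — 2 statements merged into one kernel-verified Lean document; each statement's English description precedes it below -/
import Mathlib

section
/- Let n > 0, l > -1 with (2l+3)/(n+1) > 0. For ρ in L^{n,l}(ℝ³) (spherically symmetric with ‖ρ‖_{n,l} < ∞) and 0 ≤ r ≤ r+h, the mass function m_ρ(r) = ∫_{|y|≤r} ρ(y) dy satisfies |m_ρ(r+h) − m_ρ(r)| ≤ C ‖ρ‖_{n,l} ((r+h)^{2l+3} − r^{2l+3})^{1/(n+1)}, with C depending only on n, l. -/
open Real MeasureTheory

noncomputable section

/-- `ℝ³` as a Euclidean space. -/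
abbrev E3 := EuclideanSpace ℝ (Fin 3)

/-- The mass function `m_ρ(r) = ∫_{|y| ≤ r} ρ(y) dy`. -/
def mfun (ρ : E3 → ℝ) (r : ℝ) : ℝ := ∫ y in Metric.closedBall (0 : E3) r, ρ y

theorem aux_integrable (s : ℝ) (hs : -3 < s) (b : ℝ) :
    IntegrableOn (fun x : E3 => ‖x‖ ^ s) (Metric.closedBall (0 : E3) b) := by
  have h : IntegrableOn (fun x : E3 => ‖x‖ ^ s) (Metric.ball (0 : E3) (b + 1)) := by
    rw [integrableOn_fun_norm_addHaar volume (f := fun t : ℝ => t ^ s)]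
    by_cases hb : 0 ≤ b + 1
    · have h1 := (intervalIntegral.intervalIntegrable_rpow' (a := 0) (b := b + 1)
        (r := s + 2) (by linarith))
      rw [intervalIntegrable_iff_integrableOn_Ioo_of_le hb] at h1
      refine h1.congr_fun ?_ measurableSet_Ioo
      intro y hy
      simp only [finrank_euclideanSpace, Fintype.card_fin, smul_eq_mul]
      rw [Real.rpow_add hy.1, mul_comm]
      norm_num
    · rw [Set.Ioo_eq_empty (by linarith)]
      exact integrableOn_empty
  exact h.mono_set (Metric.closedBall_subset_ball (by linarith))

theorem aux_shell (s : ℝ) (hs : -3 < s) (a b : ℝ) (ha : 0 ≤ a) (hab : a ≤ b) :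
    ∫ x in Metric.closedBall (0 : E3) b \ Metric.closedBall (0 : E3) a, ‖x‖ ^ s =
      3 * volume.real (Metric.ball (0 : E3) 1) * ((b ^ (s + 3) - a ^ (s + 3)) / (s + 3)) := by
  rw [← integral_indicator (measurableSet_closedBall.diff measurableSet_closedBall)]
  have e : ∀ x : E3, (Metric.closedBall (0 : E3) b \ Metric.closedBall (0 : E3) a).indicator
      (fun x : E3 => ‖x‖ ^ s) x = (Set.Ioc a b).indicator (fun t : ℝ => t ^ s) ‖x‖ := by
    intro x
    simp only [Set.indicator, Set.mem_diff, mem_closedBall_zero_iff, Set.mem_Ioc, not_le, and_comm]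
  simp_rw [e]
  rw [integral_fun_norm_addHaar volume (fun t => (Set.Ioc a b).indicator (fun t : ℝ => t ^ s) t)]
  have e2 : ∫ y in Set.Ioi (0:ℝ), y ^ (Module.finrank ℝ E3 - 1) •
      (Set.Ioc a b).indicator (fun t : ℝ => t ^ s) y = (b ^ (s + 3) - a ^ (s + 3)) / (s + 3) := by
    have h1 := integral_rpow (a := a) (b := b) (r := s + 2) (Or.inl (by linarith))
    rw [intervalIntegral.integral_of_le hab] at h1
    rw [show s + 3 = s + 2 + 1 by ring, ← h1, ← integral_indicator measurableSet_Ioi,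
      ← integral_indicator measurableSet_Ioc]
    congr 1
    ext y
    by_cases hy : y ∈ Set.Ioc a b
    · have hy0 : 0 < y := lt_of_le_of_lt ha hy.1
      rw [Set.indicator_of_mem (Set.mem_Ioi.2 hy0), Set.indicator_of_mem hy,
        Set.indicator_of_mem hy, Real.rpow_add hy0, mul_comm]
      simp
    · rw [Set.indicator_of_notMem hy, Set.indicator_apply_eq_zero]
      intro _
      rw [Set.indicator_of_notMem hy, smul_zero]
  rw [e2]
  simp [mul_assoc]

theorem camm_mass_function_equicontinuity (n l : ℝ) (hn : 0 < n) (hl : -1 < l) :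
    ∃ C : ℝ, 0 < C ∧ ∀ (ρ : E3 → ℝ), Measurable ρ →
      (∀ x y : E3, ‖x‖ = ‖y‖ → ρ x = ρ y) →
      Integrable (fun x => |ρ x| ^ (1 + 1/n) * ‖x‖ ^ (-(2*l/n))) →
      ∀ r h : ℝ, 0 ≤ r → 0 ≤ h →
        |mfun ρ (r + h) - mfun ρ r| ≤
          C * (∫ x, |ρ x| ^ (1 + 1/n) * ‖x‖ ^ (-(2*l/n))) ^ (n/(n+1))
            * ((r + h) ^ (2*l + 3) - r ^ (2*l + 3)) ^ (1/(n+1)) := by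
  set K : ℝ := 3 * volume.real (Metric.ball (0 : E3) 1) / (2 * l + 3) with hK
  have hl3 : 0 < 2 * l + 3 := by linarith
  have hV : 0 < volume.real (Metric.ball (0 : E3) 1) :=
    ENNReal.toReal_pos (Metric.measure_ball_pos _ _ one_pos).ne' measure_ball_lt_top.ne
  have hK0 : 0 < K := by positivity
  refine ⟨K ^ (1 / (n + 1)), by positivity, ?_⟩
  intro ρ hρ _ hint r h hr hh
  have hn1 : 0 < n + 1 := by linarith
  have hp0 : 0 < 1 + 1 / n := by positivity
  have hpq : (1 + 1 / n).HolderConjugate (n + 1) := by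
    rw [Real.holderConjugate_iff]
    refine ⟨by have : 0 < 1 / n := by positivity
               linarith, ?_⟩
    field_simp
  let f : E3 → ℝ := fun x => |ρ x| * ‖x‖ ^ (-(2 * l / (n + 1)))
  let g : E3 → ℝ := fun x => ‖x‖ ^ (2 * l / (n + 1))
  have hf0 : ∀ x, 0 ≤ f x := fun x => by positivity
  have hg0 : ∀ x, 0 ≤ g x := fun x => by positivity
  have hfm : Measurable f := by fun_prop
  have hgm : Measurable g := by fun_prop
  have hfp : ∀ x, f x ^ (1 + 1 / n) = |ρ x| ^ (1 + 1 / n) * ‖x‖ ^ (-(2 * l / n)) := by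
    intro x
    simp only [f]
    rw [Real.mul_rpow (abs_nonneg _) (by positivity), ← Real.rpow_mul (norm_nonneg _)]
    congr 2
    field_simp
  have hgq : ∀ x, g x ^ (n + 1) = ‖x‖ ^ (2 * l) := by
    intro x
    simp only [g]
    rw [← Real.rpow_mul (norm_nonneg _)]
    congr 1
    field_simp
  have hfL : MemLp f (ENNReal.ofReal (1 + 1 / n)) volume := by
    rw [← integrable_norm_rpow_iff hfm.aestronglyMeasurable (by simpa using hp0) (by simp),
      ENNReal.toReal_ofReal hp0.le]
    simp_rw [Real.norm_of_nonneg (hf0 _), hfp]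
    exact hint
  have hgL : MemLp g (ENNReal.ofReal (n + 1))
      (volume.restrict (Metric.closedBall (0 : E3) (r + h))) := by
    rw [← integrable_norm_rpow_iff hgm.aestronglyMeasurable (by simpa using hn1) (by simp),
      ENNReal.toReal_ofReal hn1.le]
    simp_rw [Real.norm_of_nonneg (hg0 _), hgq]
    exact aux_integrable (2 * l) (by linarith) (r + h)
  have hfg : ∀ᵐ x : E3, f x * g x = |ρ x| := by
    have h0 : ∀ᵐ x : E3, x ≠ 0 := by
      simp [ae_iff]
    filter_upwards [h0] with x hx
    have hx' : 0 < ‖x‖ := norm_pos_iff.2 hx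
    simp only [f, g]
    rw [mul_assoc, ← Real.rpow_add hx']
    simp
  have hρi : IntegrableOn ρ (Metric.closedBall (0 : E3) (r + h)) := by
    haveI : ENNReal.HolderConjugate (ENNReal.ofReal (1 + 1 / n)) (ENNReal.ofReal (n + 1)) :=
      hpq.ennrealOfReal
    have h1 : Integrable (f * g) (volume.restrict (Metric.closedBall (0 : E3) (r + h))) :=
      hfL.restrict _ |>.integrable_mul hgL
    refine h1.mono hρ.aestronglyMeasurable ?_
    filter_upwards [ae_restrict_of_ae hfg] with x hx
    rw [Pi.mul_apply, hx]
    simp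
  have hsub : Metric.closedBall (0 : E3) r ⊆ Metric.closedBall (0 : E3) (r + h) :=
    Metric.closedBall_subset_closedBall (by linarith)
  unfold mfun
  rw [← setIntegral_sdiff measurableSet_closedBall hρi hsub]
  set S := Metric.closedBall (0 : E3) (r + h) \ Metric.closedBall (0 : E3) r with hS
  have hH := integral_mul_le_Lp_mul_Lq_of_nonneg (μ := volume.restrict S) hpq
    (Filter.Eventually.of_forall hf0) (Filter.Eventually.of_forall hg0) (hfL.restrict _)
    (hgL.mono_measure (Measure.restrict_mono Set.diff_subset le_rfl))
  simp_rw [hfp, hgq] at hH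
  rw [aux_shell (2 * l) (by linarith) r (r + h) hr (by linarith),
    integral_congr_ae (ae_restrict_of_ae hfg)] at hH
  have hD : 0 ≤ (r + h) ^ (2 * l + 3) - r ^ (2 * l + 3) :=
    sub_nonneg.2 (Real.rpow_le_rpow hr (by linarith) hl3.le)
  have hI : ∫ x in S, |ρ x| ^ (1 + 1 / n) * ‖x‖ ^ (-(2 * l / n)) ≤
      ∫ x, |ρ x| ^ (1 + 1 / n) * ‖x‖ ^ (-(2 * l / n)) :=
    setIntegral_le_integral hint (Filter.Eventually.of_forall fun x => by positivity)
  have hI0 : 0 ≤ ∫ x in S, |ρ x| ^ (1 + 1 / n) * ‖x‖ ^ (-(2 * l / n)) :=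
    integral_nonneg fun x => by positivity
  have e1 : 3 * volume.real (Metric.ball (0 : E3) 1) *
      (((r + h) ^ (2 * l + 3) - r ^ (2 * l + 3)) / (2 * l + 3)) =
      K * ((r + h) ^ (2 * l + 3) - r ^ (2 * l + 3)) := by rw [hK]; ring
  have e2 : 1 / (1 + 1 / n) = n / (n + 1) := by field_simp
  rw [e1, e2, Real.mul_rpow hK0.le hD] at hH
  calc _ ≤ ∫ x in S, |ρ x| := abs_integral_le_integral_abs
    _ ≤ _ := hH
    _ ≤ (∫ x, |ρ x| ^ (1 + 1 / n) * ‖x‖ ^ (-(2 * l / n))) ^ (n / (n + 1)) *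
      (K ^ (1 / (n + 1)) * ((r + h) ^ (2 * l + 3) - r ^ (2 * l + 3)) ^ (1 / (n + 1))) := by
        gcongr
    _ = _ := by ring
end
end

section
/- Let n > 0, l > -1 with 4l+5−n > 0, R > 0. The linear map T : L^{n,l}(ℝ³) → L²([0,R]) defined by (Tρ)(r) = m_ρ(r)/r, where m_ρ(r) = ∫_{|y|≤r}ρ(y)dy, is a compact operator. -/
open Real MeasureTheory Filter
noncomputable section
lemma pow_aux (l : ℝ) (r : ℝ) :
    Set.EqOn (fun y : ℝ => y ^ (3 - 1) • (Set.Iic r).indicator (fun t : ℝ => t ^ (2*l)) y)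
      ((Set.Ioc 0 (max r 0)).indicator (fun y => y ^ (2*l+2))) (Set.Ioi 0) := by
  intro y hy
  have hy' : (0:ℝ) < y := hy
  by_cases h : y ≤ r
  · have h2 : y ∈ Set.Ioc 0 (max r 0) := ⟨hy', le_max_of_le_left h⟩
    simp only [Set.indicator_of_mem h2, Set.indicator_of_mem (show y ∈ Set.Iic r from h), smul_eq_mul]
    rw [Real.rpow_add hy', mul_comm]
    norm_num
  · have h2 : y ∉ Set.Ioc 0 (max r 0) := by
      rintro ⟨_, h3⟩
      rcases le_max_iff.1 h3 with h4 | h4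
      · exact h h4
      · linarith
    simp only [Set.indicator_of_notMem h2, Set.indicator_of_notMem (show y ∉ Set.Iic r from h), smul_zero]

lemma ball_ind (l : ℝ) (r : ℝ) : (Metric.closedBall (0:E3) r).indicator (fun x => ‖x‖ ^ (2*l))
    = fun x => (Set.Iic r).indicator (fun t : ℝ => t ^ (2*l)) ‖x‖ := by
  funext x
  simp [Set.indicator]

lemma weight_integrable (l : ℝ) (hl : -1 < l) (r : ℝ) :
    IntegrableOn (fun x : E3 => ‖x‖ ^ (2*l)) (Metric.closedBall (0:E3) r) := by
  rw [← integrable_indicator_iff Metric.isClosed_closedBall.measurableSet, ball_ind,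
    integrable_fun_norm_addHaar volume (f := (Set.Iic r).indicator (fun t : ℝ => t ^ (2*l)))]
  simp only [finrank_euclideanSpace, Fintype.card_fin]
  rw [integrableOn_congr_fun (pow_aux l r) measurableSet_Ioi]
  apply Integrable.integrableOn
  rw [integrable_indicator_iff measurableSet_Ioc]
  have := intervalIntegral.intervalIntegrable_rpow' (a := 0) (b := max r 0) (r := 2*l+2) (by linarith)
  rwa [intervalIntegrable_iff_integrableOn_Ioc_of_le (le_max_right _ _)] at this

lemma weight_integral (l : ℝ) (hl : -1 < l) : ∃ C : ℝ, 0 ≤ C ∧ ∀ r : ℝ,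
    ∫ x in Metric.closedBall (0:E3) r, ‖x‖ ^ (2*l) = C * (max r 0) ^ (2*l+3) := by
  refine ⟨3 * (volume.real (Metric.ball (0:E3) 1)) / (2*l+3), by
    apply div_nonneg; positivity
    linarith, fun r => ?_⟩
  rw [← integral_indicator Metric.isClosed_closedBall.measurableSet, ball_ind,
    integral_fun_norm_addHaar volume ((Set.Iic r).indicator (fun t : ℝ => t ^ (2*l)))]
  simp only [finrank_euclideanSpace, Fintype.card_fin]
  rw [setIntegral_congr_fun measurableSet_Ioi (pow_aux l r),
    setIntegral_indicator measurableSet_Ioc,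
    Set.inter_eq_right.2 (fun x hx => hx.1),
    ← intervalIntegral.integral_of_le (le_max_right _ _), integral_rpow (Or.inl (by linarith)),
    Real.zero_rpow (by linarith)]
  simp only [nsmul_eq_mul, smul_eq_mul]
  rw [show 2*l+2+1 = 2*l+3 by ring]
  push_cast
  ring

lemma holder_aux (n l : ℝ) (hn : 0 < n) (ρ : E3 → ℝ) (hmeas : Measurable ρ)
    (hint : Integrable (fun x => |ρ x| ^ (1 + 1/n) * ‖x‖ ^ (-(2*l/n)))) (A : Set E3)
    (hA : MeasurableSet A) (hw : IntegrableOn (fun x : E3 => ‖x‖ ^ (2*l)) A) :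
    IntegrableOn ρ A ∧ ∫ x in A, |ρ x| ≤
      (∫ x, |ρ x| ^ (1 + 1/n) * ‖x‖ ^ (-(2*l/n))) ^ (n/(n+1)) *
      (∫ x in A, ‖x‖ ^ (2*l)) ^ (1/(n+1)) := by
  have hp : (0:ℝ) < 1 + 1/n := by positivity
  have hq : (0:ℝ) < n + 1 := by positivity
  have hpq : (1 + 1/n).HolderConjugate (n+1) := by
    rw [Real.holderConjugate_iff]
    refine ⟨by simpa using hn, ?_⟩
    field_simp
  set f : E3 → ℝ := fun x => |ρ x| * ‖x‖ ^ (-(2*l/(n+1))) with hf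
  set g : E3 → ℝ := fun x => ‖x‖ ^ (2*l/(n+1)) with hg
  have hf0 : ∀ x, 0 ≤ f x := fun x => by positivity
  have hg0 : ∀ x, 0 ≤ g x := fun x => by positivity
  have hfm : Measurable f := by fun_prop
  have hgm : Measurable g := by fun_prop
  have hfp : ∀ x, f x ^ (1+1/n) = |ρ x| ^ (1 + 1/n) * ‖x‖ ^ (-(2*l/n)) := by
    intro x
    rw [hf]
    simp only
    rw [Real.mul_rpow (abs_nonneg _) (by positivity), ← Real.rpow_mul (norm_nonneg _)]
    congr 2
    field_simp
  have hgq : ∀ x, g x ^ (n+1) = ‖x‖ ^ (2*l) := by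
    intro x
    rw [hg]
    simp only
    rw [← Real.rpow_mul (norm_nonneg _)]
    congr 1
    field_simp
  have hfg : ∀ᵐ x ∂(volume.restrict A), f x * g x = |ρ x| := by
    apply ae_restrict_of_ae
    have : ∀ᵐ x : E3, x ≠ 0 := by
      simp [ae_iff]
    filter_upwards [this] with x hx
    have hx' : 0 < ‖x‖ := norm_pos_iff.2 hx
    simp only [hf, hg]
    rw [mul_assoc, ← Real.rpow_add hx']
    simp
  have hfL : MemLp f (ENNReal.ofReal (1+1/n)) (volume.restrict A) := by
    rw [← integrable_norm_rpow_iff hfm.aestronglyMeasurable (by simpa using hp) (by simp)]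
    rw [ENNReal.toReal_ofReal hp.le]
    refine (hint.integrableOn (s := A)).congr ?_
    filter_upwards with x
    rw [Real.norm_of_nonneg (hf0 x), hfp]
  have hgL : MemLp g (ENNReal.ofReal (n+1)) (volume.restrict A) := by
    rw [← integrable_norm_rpow_iff hgm.aestronglyMeasurable (by simpa using hq) (by simp)]
    rw [ENNReal.toReal_ofReal hq.le]
    refine hw.congr ?_
    filter_upwards with x
    rw [Real.norm_of_nonneg (hg0 x), hgq]
  have hH : (ENNReal.ofReal (1+1/n)).HolderConjugate (ENNReal.ofReal (n+1)) := hpq.ennrealOfReal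
  constructor
  · have h1 : Integrable (fun x => f x * g x) (volume.restrict A) := hfL.integrable_mul hgL
    have h2 : Integrable (fun x => |ρ x|) (volume.restrict A) := h1.congr hfg
    exact (integrable_norm_iff hmeas.aestronglyMeasurable).1 h2
  · have h := integral_mul_le_Lp_mul_Lq_of_nonneg hpq (ae_of_all _ hf0) (ae_of_all _ hg0) hfL hgL
    rw [integral_congr_ae hfg] at h
    simp only [hfp, hgq] at h
    refine h.trans ?_
    have e : 1/(1+1/n) = n/(n+1) := by field_simp
    rw [e]
    gcongr
    · exact ae_of_all _ (fun x => by positivity)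
    · exact Measure.restrict_le_self

lemma m_diff (n l : ℝ) (hn : 0 < n) (hl : -1 < l) (C : ℝ) (hC : ∀ r : ℝ,
    ∫ x in Metric.closedBall (0:E3) r, ‖x‖ ^ (2*l) = C * (max r 0) ^ (2*l+3))
    (B : ℝ) (ρ : E3 → ℝ) (hmeas : Measurable ρ)
    (hint : Integrable (fun x => |ρ x| ^ (1 + 1/n) * ‖x‖ ^ (-(2*l/n))))
    (hbound : (∫ x, |ρ x| ^ (1 + 1/n) * ‖x‖ ^ (-(2*l/n))) ^ (n/(n+1)) ≤ B) (r s : ℝ) (hrs : r ≤ s) :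
    |mfun ρ s - mfun ρ r| ≤ B * (C * (max s 0) ^ (2*l+3) - C * (max r 0) ^ (2*l+3)) ^ (1/(n+1)) := by
  have hsub := Metric.closedBall_subset_closedBall (x := (0:E3)) hrs
  have hm : ∀ r, MeasurableSet (Metric.closedBall (0:E3) r) :=
    fun r => Metric.isClosed_closedBall.measurableSet
  have h1 := holder_aux n l hn ρ hmeas hint _ (hm s) (weight_integrable l hl s)
  have h2 := holder_aux n l hn ρ hmeas hint _ ((hm s).diff (hm r))
    ((weight_integrable l hl s).mono_set Set.sdiff_subset)
  rw [mfun, mfun, ← setIntegral_sdiff (hm r) h1.1 hsub]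
  rw [← hC, ← hC, ← setIntegral_sdiff (hm r) (weight_integrable l hl s) hsub]
  refine (abs_integral_le_integral_abs).trans (h2.2.trans ?_)
  gcongr

theorem camm_T_compact (n l : ℝ) (hn : 0 < n) (hl : -1 < l) (hnl : 0 < 4*l + 5 - n)
    (R : ℝ) (hR : 0 < R) (B : ℝ)
    (ρ : ℕ → E3 → ℝ) (hmeas : ∀ j, Measurable (ρ j))
    (hsym : ∀ j, ∀ x y : E3, ‖x‖ = ‖y‖ → ρ j x = ρ j y)
    (hint : ∀ j, Integrable (fun x => |ρ j x| ^ (1 + 1/n) * ‖x‖ ^ (-(2*l/n))))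
    (hbound : ∀ j, (∫ x, |ρ j x| ^ (1 + 1/n) * ‖x‖ ^ (-(2*l/n))) ^ (n/(n+1)) ≤ B) :
    ∃ φ : ℕ → ℕ, StrictMono φ ∧ ∃ u : ℝ → ℝ,
      Tendsto (fun j => ∫⁻ r in Set.Ioc (0:ℝ) R,
          ENNReal.ofReal ((mfun (ρ (φ j)) r / r - u r) ^ 2)) atTop (nhds 0) := by
  obtain ⟨C, hC0, hC⟩ := weight_integral l hl
  have hn1 : 0 < n + 1 := by linarith
  have hκ : 0 < 1/(n+1) := by positivity
  have hB : 0 ≤ B := le_trans (Real.rpow_nonneg (integral_nonneg (fun x => by positivity)) _) (hbound 0)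
  set H : ℝ → ℝ := fun r => C * (max r 0) ^ (2*l+3) with hH
  have hHc : Continuous H := by
    refine continuous_const.mul ?_
    exact (continuous_id.max continuous_const).rpow_const (fun x => Or.inr (by linarith))
  have hHm : Monotone H := by
    intro r s hrs
    simp only [hH]
    have : 0 ≤ 2*l+3 := by linarith
    gcongr
  have key : ∀ j r s, |mfun (ρ j) s - mfun (ρ j) r| ≤ B * |H s - H r| ^ (1/(n+1)) := by
    intro j
    have h1 : ∀ r s, r ≤ s → |mfun (ρ j) s - mfun (ρ j) r| ≤ B * |H s - H r| ^ (1/(n+1)) := by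
      intro r s hrs
      rw [abs_of_nonneg (sub_nonneg.2 (hHm hrs))]
      exact m_diff n l hn hl C hC B (ρ j) (hmeas j) (hint j) (hbound j) r s hrs
    intro r s
    rcases le_total r s with h | h
    · exact h1 r s h
    · rw [abs_sub_comm, abs_sub_comm (H s)]
      exact h1 s r h
  set M : ℝ → ℝ := fun r => B * (H r) ^ (1/(n+1)) with hM
  have hm : ∀ j r, |mfun (ρ j) r| ≤ M r := by
    intro j r
    have h := key j (-1) r
    have e1 : mfun (ρ j) (-1) = 0 := by
      rw [mfun, Metric.closedBall_eq_empty.2 (by norm_num)]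
      simp
    have e2 : H (-1) = 0 := by
      simp only [hH]
      rw [max_eq_right (by norm_num), Real.zero_rpow (by linarith), mul_zero]
    have e3 : 0 ≤ H r := by simp only [hH]; positivity
    rw [e1, e2, sub_zero, sub_zero, abs_of_nonneg e3] at h
    exact h
  have hmod : ∀ r, Tendsto (fun s => B * |H s - H r| ^ (1/(n+1))) (nhds r) (nhds 0) := by
    intro r
    have hc : Continuous (fun s => B * |H s - H r| ^ (1/(n+1))) := by
      refine continuous_const.mul ?_
      exact ((hHc.sub continuous_const).abs).rpow_const (fun x => Or.inr hκ.le)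
    have := hc.tendsto r
    simpa [Real.zero_rpow hκ.ne', Real.zero_rpow (inv_pos.2 hn1).ne'] using this
  have hcont : ∀ j, Continuous (mfun (ρ j)) := by
    intro j
    rw [continuous_iff_continuousAt]
    intro r
    rw [ContinuousAt, tendsto_iff_dist_tendsto_zero]
    exact squeeze_zero (fun _ => dist_nonneg) (fun s => key j r s) (hmod r)
  obtain ⟨a, -, φ, hφ, hlim⟩ := (isCompact_univ_pi
    (fun q : ℚ => isCompact_Icc (a := -M q) (b := M q))).tendsto_subseq
    (x := fun j (q : ℚ) => mfun (ρ j) q) (fun j q _ => abs_le.1 (hm j q))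
  rw [tendsto_pi_nhds] at hlim
  have hcau : ∀ r, ∃ v, Tendsto (fun j => mfun (ρ (φ j)) r) atTop (nhds v) := by
    intro r
    apply cauchySeq_tendsto_of_complete
    rw [Metric.cauchySeq_iff]
    intro ε hε
    have h1 : ∀ᶠ s in nhds r, B * |H s - H r| ^ (1/(n+1)) < ε/3 :=
      (hmod r).eventually (gt_mem_nhds (by positivity))
    obtain ⟨U, hU, hUo, hrU⟩ := eventually_nhds_iff.1 h1
    obtain ⟨q, hq⟩ := Rat.denseRange_cast (𝕜 := ℝ) |>.exists_mem_open hUo ⟨r, hrU⟩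
    obtain ⟨N, hN⟩ := Metric.cauchySeq_iff.1 (hlim q).cauchySeq (ε/3) (by positivity)
    refine ⟨N, fun i hi j hj => ?_⟩
    have k1 := (key (φ i) r q).trans_lt (hU _ hq)
    have k2 := (key (φ j) r q).trans_lt (hU _ hq)
    have k3 := hN i hi j hj
    simp only [Function.comp, Real.dist_eq] at k3 ⊢
    rw [abs_lt] at *
    constructor <;> linarith [k1.1, k1.2, k2.1, k2.2, k3.1, k3.2]
  choose v hv using hcau
  have hvM : ∀ r, |v r| ≤ M r := fun r =>
    le_of_tendsto (hv r).abs (Eventually.of_forall fun j => hm _ r)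
  have hvmeas : Measurable v :=
    measurable_of_tendsto_metrizable (fun j => (hcont (φ j)).measurable) (tendsto_pi_nhds.2 hv)
  refine ⟨φ, hφ, fun r => v r / r, ?_⟩
  have hbd : IntegrableOn (fun r => (2 * M r / r) ^ 2) (Set.Ioc 0 R) := by
    have h1 : IntegrableOn (fun r : ℝ => (4 * B^2 * (C ^ (1/(n+1)))^2) *
        r ^ (2 * ((2*l+3) * (1/(n+1))) - 2)) (Set.Ioc 0 R) := by
      apply Integrable.const_mul
      have := intervalIntegral.intervalIntegrable_rpow' (a := 0) (b := R)
        (r := 2 * ((2*l+3) * (1/(n+1))) - 2) (by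
          have : 2 * ((2*l+3) * (1/(n+1))) - 2 + 1 = (4*l+5-n)/(n+1) := by
            field_simp
            ring
          have : 0 < (4*l+5-n)/(n+1) := by positivity
          linarith)
      rwa [intervalIntegrable_iff_integrableOn_Ioc_of_le hR.le] at this
    refine h1.congr_fun ?_ measurableSet_Ioc
    intro r hr
    have hr0 : 0 < r := hr.1
    simp only [hM, hH]
    rw [max_eq_left hr0.le, Real.mul_rpow hC0 (by positivity), ← Real.rpow_mul hr0.le,
      Real.rpow_sub hr0, mul_comm 2 ((2*l+3) * (1/(n+1))), Real.rpow_mul hr0.le _ 2]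
    norm_num
    ring
  have := tendsto_lintegral_of_dominated_convergence (μ := volume.restrict (Set.Ioc 0 R))
    (F := fun j r => ENNReal.ofReal ((mfun (ρ (φ j)) r / r - v r / r) ^ 2)) (f := fun _ => 0)
    (fun r => ENNReal.ofReal ((2 * M r / r) ^ 2))
    (fun j => by
      have := (hcont (φ j)).measurable
      fun_prop)
    (fun j => by
      filter_upwards [ae_restrict_mem measurableSet_Ioc] with r hr
      apply ENNReal.ofReal_le_ofReal
      have hr0 : 0 < r := hr.1
      rw [← sub_div, sq_le_sq, abs_div, abs_div]
      refine div_le_div_of_nonneg_right ?_ (abs_nonneg r)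
      have h1 := hm (φ j) r
      have h2 := hvM r
      calc |mfun (ρ (φ j)) r - v r| ≤ |mfun (ρ (φ j)) r| + |v r| := abs_sub _ _
        _ ≤ 2 * M r := by linarith
        _ ≤ _ := le_abs_self _)
    (Integrable.lintegral_lt_top hbd).ne
    (by
      refine ae_of_all _ fun r => ?_
      have h : Tendsto (fun j => (mfun (ρ (φ j)) r / r - v r / r) ^ 2) atTop
          (nhds ((v r / r - v r / r) ^ 2)) := (((hv r).div_const r).sub_const _).pow 2
      have h2 := ENNReal.tendsto_ofReal h
      simpa using h2)
  simpa using this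
end
end
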